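/- arXiv:2309.17062 — 2 statements merged into one kernel-verified Lean document; each statement's English description precedes it below -/
import Mathlib

section
/- Let K be a field. Define K[t]-linear maps φ : ∏_{m∈ℕ} K[t] → ∏_{m∈ℕ} K[t] by φ((a_m)_m)_0 = t·a_0 and φ((a_m)_m)_m = t·a_m − a_{m−1} for m ≥ 1, and Σ : ∏_{m∈ℕ} K[t] → K[[t]] by Σ((b_m)_m) = Σ_{m∈ℕ} b_m·t^m. Then the kernel of Σ equals the range of φ. -/
open Polynomial Finset

noncomputable section

/-- The `K[t]`-linear map `Σ : ∏_{m∈ℕ} K[t] → K[[t]]`, `Σ((b_m)_m) = Σ_{m∈ℕ} b_m·t^m`: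
the coefficient of `t^N` in `Σ((b_m)_m)` is `Σ_{m ≤ N} (coefficient of t^{N−m} in b_m)`,
so only the terms with `m ≤ N` contribute.  Here `K[[t]]` is a `K[t]`-module via the
coercion of polynomials to power series. -/
def sigmaMap (K : Type*) [Field K] :
    (ℕ → Polynomial K) →ₗ[Polynomial K] PowerSeries K where
  toFun b := PowerSeries.mk fun N => ∑ m ∈ Finset.range (N + 1), (b m).coeff (N - m)
  map_add' a b := by
    ext N
    simp [Finset.sum_add_distrib]
  map_smul' p b := by
    ext N
    rw [RingHom.id_apply]
    conv_rhs => rw [Algebra.smul_def, PowerSeries.coeff_mul]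
    simp only [PowerSeries.coeff_mk, Pi.smul_apply, smul_eq_mul, Polynomial.coeff_mul,
      PowerSeries.algebraMap_apply', PowerSeries.coeff_map, Algebra.algebraMap_self,
      RingHom.id_apply, Polynomial.coeff_coe]
    simp only [Finset.Nat.sum_antidiagonal_eq_sum_range_succ_mk]
    rw [Finset.sum_comm' (t' := Finset.range (N + 1))
      (s' := fun i => Finset.range (N - i + 1)) (by intro m i; simp only [mem_range]; omega)]
    refine Finset.sum_congr rfl fun i hi => ?_
    rw [Finset.mul_sum]
    refine Finset.sum_congr rfl fun m hm => ?_
    congr 2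
    omega

/-- The `K[t]`-linear map `φ : ∏_{m∈ℕ} K[t] → ∏_{m∈ℕ} K[t]` with `φ((a_m)_m)_0 = t·a_0` and
`φ((a_m)_m)_m = t·a_m − a_{m−1}` for `m ≥ 1`. -/
def prodShiftMap (K : Type*) [Field K] :
    (ℕ → Polynomial K) →ₗ[Polynomial K] (ℕ → Polynomial K) where
  toFun a m := match m with
    | 0 => X * a 0
    | m + 1 => X * a (m + 1) - a m
  map_add' a b := by
    funext m
    match m with
    | 0 => simp [mul_add]
    | m + 1 => simp [mul_add]; ring
  map_smul' c a := by
    funext m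
    match m with
    | 0 => simp [smul_eq_mul]; ring
    | m + 1 => simp [smul_eq_mul]; ring

/-- The partial sums of `Σ` have the same coefficients as `Σ` in low degree. -/
theorem coeff_sum_range_mul_X_pow {K : Type*} [Field K] (b : ℕ → Polynomial K) {N n : ℕ}
    (h : N < n) :
    (∑ m ∈ Finset.range n, b m * X ^ m).coeff N = PowerSeries.coeff N (sigmaMap K b) := by
  have hs : PowerSeries.coeff N (sigmaMap K b) =
      ∑ m ∈ Finset.range (N + 1), (b m).coeff (N - m) := by
    simp [sigmaMap]
  rw [hs, Polynomial.finsetSum_coeff]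
  symm
  refine Finset.sum_subset_zero_on_sdiff (Finset.range_mono h) (fun m hm => ?_) fun m hm => ?_
  · simp only [mem_sdiff, mem_range] at hm
    rw [Polynomial.coeff_mul_X_pow', if_neg (by omega)]
  · rw [Polynomial.coeff_mul_X_pow', if_pos (by simp only [mem_range] at hm; omega)]

theorem mem_ker_sigmaMap_iff {K : Type*} [Field K] {b : ℕ → Polynomial K} :
    b ∈ LinearMap.ker (sigmaMap K) ↔
      ∀ n, X ^ (n + 1) ∣ ∑ m ∈ Finset.range (n + 1), b m * X ^ m := by
  simp only [LinearMap.mem_ker, Polynomial.X_pow_dvd_iff]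
  refine ⟨fun h n N hN => by rw [coeff_sum_range_mul_X_pow b hN, h, map_zero], fun h => ?_⟩
  ext N
  rw [← coeff_sum_range_mul_X_pow b N.lt_succ_self, h N N N.lt_succ_self, map_zero]

theorem prodShiftMap_eq_iff {K : Type*} [Field K] {a b : ℕ → Polynomial K} :
    prodShiftMap K a = b ↔
      ∀ n, ∑ m ∈ Finset.range (n + 1), b m * X ^ m = X ^ (n + 1) * a n := by
  have h0 : prodShiftMap K a 0 = X * a 0 := rfl
  have hsucc (m : ℕ) : prodShiftMap K a (m + 1) = X * a (m + 1) - a m := rfl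
  constructor
  · rintro rfl n
    induction n with
    | zero => simp [h0]
    | succ n ih =>
      rw [Finset.sum_range_succ, ih, hsucc]
      ring
  · intro h
    funext m
    cases m with
    | zero => simpa [h0] using (h 0).symm
    | succ m =>
      have hm := h (m + 1)
      rw [Finset.sum_range_succ, h m] at hm
      rw [hsucc]
      refine mul_right_cancel₀ (pow_ne_zero (m + 1) Polynomial.X_ne_zero) ?_
      linear_combination -hm

/-- With `φ : ∏_{m∈ℕ} K[t] → ∏_{m∈ℕ} K[t]` defined by `φ((a_m)_m)_0 = t·a_0`
and `φ((a_m)_m)_m = t·a_m − a_{m−1}` for `m ≥ 1`, and `Σ : ∏_{m∈ℕ} K[t] → K[[t]]` defined by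
`Σ((b_m)_m) = Σ_{m∈ℕ} b_m·t^m`, the kernel of `Σ` equals the range of `φ`. -/
theorem ker_sigmaMap_eq_range_prodShiftMap (K : Type*) [Field K] :
    LinearMap.ker (sigmaMap K) = LinearMap.range (prodShiftMap K) := by
  ext b
  simp only [mem_ker_sigmaMap_iff, LinearMap.mem_range, prodShiftMap_eq_iff]
  exact Classical.skolem
end
end

section
/- Let K be a field. Define K[t]-linear maps φ' : ∏_{m∈ℕ} K[t] → ∏_{m∈ℕ} K[t] by φ'((a_m)_m)_m = t·a_{m+1} − a_m, and Σ : ∏_{m∈ℕ} K[t] → K[[t]] by Σ((b_m)_m) = Σ_{m∈ℕ} b_m·t^m. Let q : K[[t]] → K[[t]]/K[t] be the quotient by the image of the coercion K[t] → K[[t]]. Then q ∘ Σ is surjective and its kernel equals the range of φ'; consequently Σ induces an isomorphism of K[t]-modules (∏_{m∈ℕ} K[t]) / range(φ') ≅ K[[t]]/K[t]. -/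
open Polynomial Finset

noncomputable section

/-- The `K[t]`-linear map `φ' : ∏_{m∈ℕ} K[t] → ∏_{m∈ℕ} K[t]` with
`φ'((a_m)_m)_m = t·a_{m+1} − a_m`. -/
def prodShiftMap' (K : Type*) [Field K] :
    (ℕ → Polynomial K) →ₗ[Polynomial K] (ℕ → Polynomial K) where
  toFun a m := X * a (m + 1) - a m
  map_add' a b := by
    funext m
    simp [mul_add]
    ring
  map_smul' c a := by
    funext m
    simp [smul_eq_mul]
    ring

/-- The image of the coercion `K[t] → K[[t]]`, as a `K[t]`-submodule of `K[[t]]`. -/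
def polynomialSubmodule (K : Type*) [Field K] : Submodule (Polynomial K) (PowerSeries K) :=
  LinearMap.range (Algebra.linearMap (Polynomial K) (PowerSeries K))

theorem coeff_sigmaMap {K : Type*} [Field K] (b : ℕ → K[X]) (N : ℕ) :
    PowerSeries.coeff N (sigmaMap K b) = ∑ m ∈ range (N + 1), (b m).coeff (N - m) := by
  simp [sigmaMap]

theorem mem_polynomialSubmodule {K : Type*} [Field K] {f : PowerSeries K} :
    f ∈ polynomialSubmodule K ↔ ∃ p : K[X], (p : PowerSeries K) = f := by
  simp [polynomialSubmodule, PowerSeries.algebraMap_apply']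

theorem sigmaMap_prodShiftMap' {K : Type*} [Field K] (a : ℕ → K[X]) :
    sigmaMap K (prodShiftMap' K a) = ((-a 0 : K[X]) : PowerSeries K) := by
  ext N
  have h : ∀ m ∈ range N, (prodShiftMap' K a m).coeff (N - m) =
      (a (m + 1)).coeff (N - (m + 1)) - (a m).coeff (N - m) := by
    intro m hm
    obtain ⟨k, rfl⟩ := Nat.exists_eq_add_of_lt (mem_range.mp hm)
    rw [show m + k + 1 - m = k + 1 by lia, show m + k + 1 - (m + 1) = k by lia]
    simp [prodShiftMap']
  rw [coeff_sigmaMap, sum_range_succ, sum_congr rfl h,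
    sum_range_sub fun m => (a m).coeff (N - m)]
  simp only [prodShiftMap', LinearMap.coe_mk, AddHom.coe_mk, Nat.sub_self, coeff_sub,
    mul_coeff_zero, coeff_X_zero, zero_mul, Nat.sub_zero, Polynomial.coeff_coe, coeff_neg]
  ring

theorem sigmaMap_C_coeff {K : Type*} [Field K] (f : PowerSeries K) :
    sigmaMap K (fun m => C (PowerSeries.coeff m f)) = f := by
  ext N
  rw [coeff_sigmaMap, sum_eq_single_of_mem N (self_mem_range_succ N)]
  · simp
  · intro m hm hne
    have hm' := mem_range.mp hm
    exact coeff_C_of_ne_zero (by lia)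

/-- The sequence `a` with `a 0 = -p` and `X * a (m + 1) = a m + b m` whenever the latter is
divisible by `X`. -/
def shiftPreimage {K : Type*} [Field K] (p : K[X]) (b : ℕ → K[X]) : ℕ → K[X]
  | 0 => -p
  | m + 1 => divX (shiftPreimage p b m + b m)

theorem coeff_shiftPreimage {K : Type*} [Field K] {p : K[X]} {b : ℕ → K[X]}
    (h : (p : PowerSeries K) = sigmaMap K b) (m N : ℕ) :
    (shiftPreimage p b m).coeff N = -∑ j ∈ range (N + 1), (b (m + j)).coeff (N - j) := by
  induction m generalizing N with
  | zero =>
    rw [shiftPreimage, coeff_neg, ← Polynomial.coeff_coe, h, coeff_sigmaMap]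
    simp
  | succ m ih =>
    rw [shiftPreimage, coeff_divX, coeff_add, ih, sum_range_succ']
    simp [add_assoc, add_comm 1]

theorem prodShiftMap'_shiftPreimage {K : Type*} [Field K] {p : K[X]} {b : ℕ → K[X]}
    (h : (p : PowerSeries K) = sigmaMap K b) :
    prodShiftMap' K (shiftPreimage p b) = b := by
  funext m
  have h₀ : (shiftPreimage p b m + b m).coeff 0 = 0 := by
    simp [coeff_shiftPreimage h]
  have h₁ := X_mul_divX_add (shiftPreimage p b m + b m)
  rw [h₀, map_zero, add_zero] at h₁
  change X * divX (shiftPreimage p b m + b m) - shiftPreimage p b m = b m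
  rw [h₁, add_sub_cancel_left]

theorem surjective_mkQ_comp_sigmaMap (K : Type*) [Field K] :
    Function.Surjective ((polynomialSubmodule K).mkQ ∘ₗ sigmaMap K) :=
  (Submodule.mkQ_surjective _).comp fun f => ⟨_, sigmaMap_C_coeff f⟩

theorem ker_mkQ_comp_sigmaMap (K : Type*) [Field K] :
    LinearMap.ker ((polynomialSubmodule K).mkQ ∘ₗ sigmaMap K) =
      LinearMap.range (prodShiftMap' K) := by
  ext b
  rw [LinearMap.ker_comp, Submodule.ker_mkQ, Submodule.mem_comap, mem_polynomialSubmodule,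
    LinearMap.mem_range]
  constructor
  · rintro ⟨p, hp⟩
    exact ⟨_, prodShiftMap'_shiftPreimage hp⟩
  · rintro ⟨a, rfl⟩
    exact ⟨-a 0, (sigmaMap_prodShiftMap' a).symm⟩

/-- With `φ'((a_m)_m)_m = t·a_{m+1} − a_m`, `Σ((b_m)_m) = Σ_{m∈ℕ} b_m·t^m`,
and `q : K[[t]] → K[[t]]/K[t]` the quotient map by the image of the coercion `K[t] → K[[t]]`:
the composite `q ∘ Σ` is surjective and its kernel equals the range of `φ'`; consequently `Σ`
induces an isomorphism of `K[t]`-modules `(∏_{m∈ℕ} K[t]) / range(φ') ≅ K[[t]]/K[t]`. -/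
theorem quotient_sigma_exact (K : Type*) [Field K] :
    Function.Surjective ((polynomialSubmodule K).mkQ ∘ₗ sigmaMap K) ∧
    LinearMap.ker ((polynomialSubmodule K).mkQ ∘ₗ sigmaMap K) =
      LinearMap.range (prodShiftMap' K) ∧
    Nonempty
      (((ℕ → Polynomial K) ⧸ LinearMap.range (prodShiftMap' K)) ≃ₗ[Polynomial K]
        (PowerSeries K ⧸ polynomialSubmodule K)) := by
  exact ⟨surjective_mkQ_comp_sigmaMap K, ker_mkQ_comp_sigmaMap K,
    ⟨(Submodule.quotEquivOfEq _ _ (ker_mkQ_comp_sigmaMap K).symm).trans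
      (LinearMap.quotKerEquivOfSurjective _ (surjective_mkQ_comp_sigmaMap K))⟩⟩
end
end
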